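/- Let Θ be a suitable set of moduli of continuity and let f be a weak Θ-Carathéodory function f : ℝ × ℝ^N → ℝ^M. For each j ∈ ℕ and each compact interval I = [q₁,q₂] with rational endpoints, if (x_n) is a sequence in K_j^I converging uniformly to x ∈ K_j^I, then for all rationals p₁, p₂ with q₁ ≤ p₁ < p₂ ≤ q₂ one has ∫_{p₁}^{p₂} f(t, x_n(t)) dt → ∫_{p₁}^{p₂} f(t, x(t)) dt as n → ∞. -/

import Mathlib

open MeasureTheory Set Filter Topology
open scoped RealInnerProductSpace

noncomputable section

abbrev Euc (n : ℕ) := EuclideanSpace ℝ (Fin n)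

/-- A function `ℝ → ℝ` is locally integrable (w.r.t. Lebesgue measure) on every
compact interval. -/
def LocInt (m : ℝ → ℝ) : Prop := ∀ a b : ℝ, IntegrableOn m (Icc a b)

section Defs

variable {N : ℕ} {F : Type*} [NormedAddCommGroup F] [NormedSpace ℝ F]

/-- The Carathéodory conditions (C1) and (C2). -/
def IsCara (f : ℝ → Euc N → F) : Prop :=
  StronglyMeasurable (Function.uncurry f) ∧
  ∀ K : Set (Euc N), IsCompact K → ∃ m : ℝ → ℝ, (∀ t, 0 ≤ m t) ∧ LocInt m ∧
    ∀ᵐ t : ℝ, ∀ x ∈ K, ‖f t x‖ ≤ m t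

/-- A suitable set of moduli of continuity `Θ = {θ_j^{[q₁,q₂]}}`. -/
structure SuitableModuli where
  θ : ℕ → ℚ → ℚ → ℝ → ℝ
  nonneg : ∀ j q₁ q₂ s, (0:ℝ) ≤ s → 0 ≤ θ j q₁ q₂ s
  cont : ∀ j q₁ q₂, ContinuousOn (θ j q₁ q₂) (Ici 0)
  mono : ∀ j q₁ q₂, MonotoneOn (θ j q₁ q₂) (Ici 0)
  zero : ∀ j q₁ q₂, θ j q₁ q₂ 0 = 0
  ordered : ∀ j₁ j₂ q₁ q₂ p₁ p₂, j₁ ≤ j₂ → p₁ ≤ q₁ → q₂ ≤ p₂ →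
    ∀ s : ℝ, 0 ≤ s → θ j₁ q₁ q₂ s ≤ θ j₂ p₁ p₂ s

/-- `x ∈ K_j^{[q₁,q₂]}`: continuous, bounded by `j` and with modulus of continuity
`θ_j^{[q₁,q₂]}` on `[q₁,q₂]`. -/
def inK {N : ℕ} (Θ : SuitableModuli) (j : ℕ) (q₁ q₂ : ℚ) (x : ℝ → Euc N) : Prop :=
  ContinuousOn x (Icc (q₁:ℝ) (q₂:ℝ)) ∧
  (∀ t ∈ Icc (q₁:ℝ) (q₂:ℝ), ‖x t‖ ≤ (j:ℝ)) ∧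
  ∀ t ∈ Icc (q₁:ℝ) (q₂:ℝ), ∀ s ∈ Icc (q₁:ℝ) (q₂:ℝ), ‖x t - x s‖ ≤ Θ.θ j q₁ q₂ |t - s|

/-- Weak Θ-Carathéodory functions: Carathéodory conditions plus condition (W). -/
def IsWTC (Θ : SuitableModuli) (f : ℝ → Euc N → F) : Prop :=
  IsCara f ∧
  ∀ (j : ℕ) (q₁ q₂ : ℚ) (xs : ℕ → ℝ → Euc N) (x : ℝ → Euc N),
    (∀ n, inK Θ j q₁ q₂ (xs n)) → inK Θ j q₁ q₂ x →
    TendstoUniformlyOn (fun n t => xs n t) x atTop (Icc (q₁:ℝ) (q₂:ℝ)) →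
    Tendsto (fun n => ∫ t in Icc (q₁:ℝ) (q₂:ℝ), f t (xs n t)) atTop
      (𝓝 (∫ t in Icc (q₁:ℝ) (q₂:ℝ), f t (x t)))

/-- Convergence in the `σ_Θ` sense:
`sup_{x ∈ K_j^I} ‖∫_I (f_n(t,x(t)) − f(t,x(t))) dt‖ → 0` for every `j` and `I`. -/
def SigmaTendsto (Θ : SuitableModuli) (fs : ℕ → ℝ → Euc N → F) (f : ℝ → Euc N → F) : Prop :=
  ∀ (j : ℕ) (q₁ q₂ : ℚ), ∀ ε > (0:ℝ), ∀ᶠ n in atTop, ∀ x : ℝ → Euc N, inK Θ j q₁ q₂ x →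
    ‖∫ t in Icc (q₁:ℝ) (q₂:ℝ), (fs n t (x t) - f t (x t))‖ < ε

end Defs

/-- Lipschitz Carathéodory functions. -/
def IsLC {N : ℕ} (f : ℝ → Euc N → Euc N) : Prop :=
  IsCara f ∧
  ∀ K : Set (Euc N), IsCompact K → ∃ l : ℝ → ℝ, LocInt l ∧
    ∀ᵐ t : ℝ, ∀ x ∈ K, ∀ y ∈ K, ‖f t x - f t y‖ ≤ l t * ‖x - y‖

/-- The optimal m-bound of `f` on the closed ball `B_j`. -/
def mOpt {N : ℕ} (f : ℝ → Euc N → Euc N) (j : ℕ) (t : ℝ) : ℝ :=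
  sSup {v : ℝ | ∃ x : Euc N, ‖x‖ ≤ (j:ℝ) ∧ v = ‖f t x‖}

/-- The time translation `f_r(s,x) = f(s+r,x)`. -/
def timeTranslate {N : ℕ} (f : ℝ → Euc N → Euc N) (r : ℝ) : ℝ → Euc N → Euc N :=
  fun s x => f (s + r) x

/-- `x` is a solution of `ẋ = g(t,x)`, `x(0) = x₀`, defined on `[0,∞)`. -/
def IsSolOn {N : ℕ} (g : ℝ → Euc N → Euc N) (x₀ : Euc N) (x : ℝ → Euc N) : Prop :=
  ContinuousOn x (Ici 0) ∧ ∀ t ∈ Ici (0:ℝ), x t = x₀ + ∫ s in (0:ℝ)..t, g s (x s)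

/-- A Carathéodory function composed with a bounded continuous curve is integrable on
compact intervals. -/
theorem IsCara.integrableOn_comp {N : ℕ} {F : Type*} [NormedAddCommGroup F]
    {f : ℝ → Euc N → F} (hf : IsCara f) {y : ℝ → Euc N} (hy : Continuous y) {r : ℝ}
    (hr : ∀ t, ‖y t‖ ≤ r) (a b : ℝ) : IntegrableOn (fun t => f t (y t)) (Icc a b) := by
  obtain ⟨m, -, hm, hb⟩ := hf.2 _ (isCompact_closedBall (0 : Euc N) r)
  refine Integrable.mono' (hm a b) ?_ (ae_restrict_of_ae ?_)
  · exact (hf.1.comp_measurable (measurable_id.prodMk hy.measurable)).aestronglyMeasurable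
  · filter_upwards [hb] with t ht
    exact ht _ (by simpa using hr t)

/-- Constant curves belong to every `K_j^I` with `j` at least their norm. -/
theorem inK_const {N : ℕ} (Θ : SuitableModuli) {j : ℕ} (q₁ q₂ : ℚ) {c : Euc N}
    (hc : ‖c‖ ≤ j) : inK Θ j q₁ q₂ (fun _ => c) :=
  ⟨continuousOn_const, fun _ _ => hc, fun t _ s _ => by
    simpa using Θ.nonneg j q₁ q₂ |t - s| (abs_nonneg _)⟩

/-- Freezing a curve of `K_j^{[q₁,q₂]}` outside a subinterval keeps it in `K_j^{[q₁,q₂]}`. -/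
theorem inK.comp_projIcc {N : ℕ} {Θ : SuitableModuli} {j : ℕ} {q₁ q₂ : ℚ} {x : ℝ → Euc N}
    (hx : inK Θ j q₁ q₂ x) {a b : ℝ} (hab : a ≤ b) (ha : (q₁ : ℝ) ≤ a) (hb : b ≤ (q₂ : ℝ)) :
    Continuous (fun t => x (projIcc a b hab t)) ∧ (∀ t, ‖x (projIcc a b hab t)‖ ≤ j) ∧
      inK Θ j q₁ q₂ (fun t => x (projIcc a b hab t)) := by
  have hmem (t : ℝ) : (projIcc a b hab t : ℝ) ∈ Icc (q₁ : ℝ) q₂ :=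
    Icc_subset_Icc ha hb (projIcc a b hab t).2
  have hcont : Continuous (fun t => x (projIcc a b hab t)) :=
    hx.1.comp_continuous (continuous_subtype_val.comp continuous_projIcc) hmem
  refine ⟨hcont, fun t => hx.2.1 _ (hmem t), hcont.continuousOn, fun t _ => hx.2.1 _ (hmem t),
    fun t _ s _ => (hx.2.2 _ (hmem t) _ (hmem s)).trans ?_⟩
  exact Θ.mono j q₁ q₂ (mem_Ici.2 (abs_nonneg _)) (mem_Ici.2 (abs_nonneg _))
    (abs_projIcc_sub_projIcc hab)

/-- Splitting the integral along a curve frozen outside `[a, b]`. -/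
theorem setIntegral_comp_projIcc {N : ℕ} {F : Type*} [NormedAddCommGroup F] [NormedSpace ℝ F]
    {f : ℝ → Euc N → F} {x : ℝ → Euc N} {a b c d : ℝ} (hca : c ≤ a) (hab : a ≤ b) (hbd : b ≤ d)
    (hf_int : IntegrableOn (fun t => f t (x (projIcc a b hab t))) (Icc c d)) :
    ∫ t in Icc a b, f t (x t) = (∫ t in Icc c d, f t (x (projIcc a b hab t)))
      - (∫ t in Icc c a, f t (x a)) - ∫ t in Icc b d, f t (x b) := by
  have e₁ : ∫ t in Icc a b, f t (x t) = ∫ t in Icc a b, f t (x (projIcc a b hab t)) :=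
    setIntegral_congr_fun measurableSet_Icc fun t ht => by simp [projIcc_of_mem hab ht]
  have e₂ : ∫ t in Icc c a, f t (x a) = ∫ t in Icc c a, f t (x (projIcc a b hab t)) :=
    setIntegral_congr_fun measurableSet_Icc fun t ht => by simp [projIcc_of_le_left hab ht.2]
  have e₃ : ∫ t in Icc b d, f t (x b) = ∫ t in Icc b d, f t (x (projIcc a b hab t)) :=
    setIntegral_congr_fun measurableSet_Icc fun t ht => by simp [projIcc_of_right_le hab ht.1]
  have hi {u v : ℝ} (huv : u ≤ v) (hu : c ≤ u) (hv : v ≤ d) :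
      IntervalIntegrable (fun t => f t (x (projIcc a b hab t))) volume u v :=
    (intervalIntegrable_iff_integrableOn_Icc_of_le huv).2
      (hf_int.mono_set (Icc_subset_Icc hu hv))
  have h₁ := hi hca le_rfl (hab.trans hbd)
  have h₂ := hi hab hca hbd
  have h₃ := hi hbd (hca.trans hab) le_rfl
  rw [e₁, e₂, e₃]
  simp only [integral_Icc_eq_integral_Ioc]
  rw [← intervalIntegral.integral_of_le hca, ← intervalIntegral.integral_of_le hab,
    ← intervalIntegral.integral_of_le hbd,
    ← intervalIntegral.integral_of_le (hca.trans (hab.trans hbd)),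
    ← intervalIntegral.integral_add_adjacent_intervals (h₁.trans h₂) h₃,
    ← intervalIntegral.integral_add_adjacent_intervals h₁ h₂]
  abel

/-- Condition (W) along convergent sequences of constant curves. -/
theorem IsWTC.tendsto_setIntegral_const {N : ℕ} {F : Type*} [NormedAddCommGroup F]
    [NormedSpace ℝ F] {Θ : SuitableModuli} {f : ℝ → Euc N → F} (hf : IsWTC Θ f) {j : ℕ}
    {cs : ℕ → Euc N} {c : Euc N} (hcs : ∀ n, ‖cs n‖ ≤ j) (hc : ‖c‖ ≤ j)
    (h : Tendsto cs atTop (𝓝 c)) (q₁ q₂ : ℚ) :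
    Tendsto (fun n => ∫ t in Icc (q₁ : ℝ) q₂, f t (cs n)) atTop
      (𝓝 (∫ t in Icc (q₁ : ℝ) q₂, f t c)) := by
  refine hf.2 j q₁ q₂ (fun n _ => cs n) (fun _ => c) (fun n => inK_const Θ q₁ q₂ (hcs n))
    (inK_const Θ q₁ q₂ hc) (Metric.tendstoUniformlyOn_iff.2 fun ε hε => ?_)
  filter_upwards [Metric.tendsto_nhds.1 h ε hε] with n hn t _
  rwa [dist_comm]

/-- For a weak Θ-Carathéodory function, the convergence of integrals in
condition (W) also holds on rational subintervals `[p₁,p₂] ⊆ [q₁,q₂]`. -/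
theorem stmt1 {N M : ℕ} (Θ : SuitableModuli) (f : ℝ → Euc N → Euc M)
    (hf : IsWTC Θ f) (j : ℕ) (q₁ q₂ : ℚ)
    (xs : ℕ → ℝ → Euc N) (x : ℝ → Euc N)
    (hxs : ∀ n, inK Θ j q₁ q₂ (xs n)) (hx : inK Θ j q₁ q₂ x)
    (hconv : TendstoUniformlyOn (fun n t => xs n t) x atTop (Icc (q₁:ℝ) (q₂:ℝ)))
    (p₁ p₂ : ℚ) (h₁ : q₁ ≤ p₁) (h₂ : p₁ < p₂) (h₃ : p₂ ≤ q₂) :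
    Tendsto (fun n => ∫ t in Icc (p₁:ℝ) (p₂:ℝ), f t (xs n t)) atTop
      (𝓝 (∫ t in Icc (p₁:ℝ) (p₂:ℝ), f t (x t))) := by
  have h₁' : (q₁ : ℝ) ≤ p₁ := by exact_mod_cast h₁
  have h₂' : (p₁ : ℝ) ≤ p₂ := by exact_mod_cast h₂.le
  have h₃' : (p₂ : ℝ) ≤ q₂ := by exact_mod_cast h₃
  have m₁ : (p₁ : ℝ) ∈ Icc (q₁ : ℝ) q₂ := ⟨h₁', h₂'.trans h₃'⟩
  have m₂ : (p₂ : ℝ) ∈ Icc (q₁ : ℝ) q₂ := ⟨h₁'.trans h₂', h₃'⟩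
  have split {y : ℝ → Euc N} (hy : inK Θ j q₁ q₂ y) :=
    setIntegral_comp_projIcc h₁' h₂' h₃' (hf.1.integrableOn_comp
      (hy.comp_projIcc h₂' h₁' h₃').1 (hy.comp_projIcc h₂' h₁' h₃').2.1 q₁ q₂)
  simp only [split hx, fun n => split (hxs n)]
  refine (Tendsto.sub ?_ ?_).sub ?_
  · refine hf.2 j q₁ q₂ _ _ (fun n => ((hxs n).comp_projIcc h₂' h₁' h₃').2.2)
      (hx.comp_projIcc h₂' h₁' h₃').2.2 ((hconv.comp _).mono fun t _ => ?_)
    exact Icc_subset_Icc h₁' h₃' (projIcc (p₁ : ℝ) p₂ h₂' t).2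
  · exact hf.tendsto_setIntegral_const (fun n => (hxs n).2.1 _ m₁) (hx.2.1 _ m₁)
      (hconv.tendsto_at m₁) q₁ p₁
  · exact hf.tendsto_setIntegral_const (fun n => (hxs n).2.1 _ m₂) (hx.2.1 _ m₂)
      (hconv.tendsto_at m₂) p₂ q₂
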